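/- arXiv:1804.05047 — 2 statements merged into one kernel-verified Lean document; each statement's English description precedes it below -/
import Mathlib

section
/- Let S = ((n₁,m₁),…,(n_k,m_k)) be a shape with m₁ ≥ 4 and n₁ ≥ 2, let N = Σᵢ nᵢmᵢ, and let d be an integer with d ≥ N − n₁. Then C(N,2) + Σ_{i=1}^k nᵢ·C(mᵢ+1,2) ≤ N·d. (Equivalently, τ'(S) := C(N,2) − Σᵢ nᵢC(mᵢ,2) + Σᵢ nᵢmᵢ² ≤ Nd.) -/
/-- A sum of terms `nᵢ mᵢ²` is at most the square of the sum of the `nᵢ mᵢ`. -/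
theorem sum_mul_sq_le_sq_sum_mul {ι : Type*} (s : Finset ι) (n m : ι → ℕ) :
    ∑ i ∈ s, n i * m i ^ 2 ≤ (∑ i ∈ s, n i * m i) ^ 2 := by
  calc ∑ i ∈ s, n i * m i ^ 2 ≤ ∑ i ∈ s, (n i * m i) ^ 2 := by
        refine Finset.sum_le_sum fun i _ => ?_
        rw [mul_pow]
        exact Nat.mul_le_mul_right _ (Nat.le_self_pow two_ne_zero _)
    _ ≤ (∑ i ∈ s, n i * m i) ^ 2 :=
        Finset.sum_sq_le_sq_sum_of_nonneg fun i _ => Nat.zero_le _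

theorem two_mul_choose_two_cast (a : ℕ) : 2 * (a.choose 2 : ℤ) = a * (a - 1) := by
  have h := Nat.cast_choose_two ℚ a
  have h' : 2 * (a.choose 2 : ℚ) = a * (a - 1) := by rw [h]; ring
  exact_mod_cast h'

/-- Let `S = ((n₁,m₁),…,(n_k,m_k))` be a shape (all `nᵢ, mᵢ` positive,
`k ≥ 1`) with `m₁ ≥ 4` and `n₁ ≥ 2`, let `N = Σᵢ nᵢmᵢ`, and let `d` be an integer with
`d ≥ N − n₁`.  Then `C(N,2) + Σᵢ nᵢ·C(mᵢ+1,2) ≤ N·d`. -/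
theorem shape_bound_m1_ge_four
    (k : ℕ) (hk : 0 < k) (n m : Fin k → ℕ)
    (hn : ∀ i, 0 < n i) (hm : ∀ i, 0 < m i)
    (N : ℕ) (hN : N = ∑ i, n i * m i)
    (hm1 : 4 ≤ m ⟨0, hk⟩) (hn1 : 2 ≤ n ⟨0, hk⟩)
    (d : ℤ) (hd : (N : ℤ) - (n ⟨0, hk⟩ : ℤ) ≤ d) :
    (N.choose 2 : ℤ) + ∑ i, (n i : ℤ) * ((m i + 1).choose 2 : ℤ) ≤ (N : ℤ) * d := by
  obtain ⟨k, rfl⟩ : ∃ j, k = j + 1 := ⟨k - 1, by omega⟩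
  change 4 ≤ m 0 at hm1
  change 2 ≤ n 0 at hn1
  change (N : ℤ) - (n 0 : ℤ) ≤ d at hd
  have hsum : 2 * ∑ i, (n i : ℤ) * ((m i + 1).choose 2 : ℤ)
      = ∑ i, (n i : ℤ) * (m i : ℤ) ^ 2 + N := by
    rw [hN, Finset.mul_sum]
    push_cast
    rw [← Finset.sum_add_distrib]
    refine Finset.sum_congr rfl fun i _ => ?_
    have h := two_mul_choose_two_cast (m i + 1)
    push_cast at h
    linear_combination (n i : ℤ) * h
  have hrest := sum_mul_sq_le_sq_sum_mul Finset.univ (fun i : Fin k => n i.succ)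
    (fun i => m i.succ)
  have hN' : (N : ℤ) = n 0 * m 0 + ∑ i : Fin k, (n i.succ : ℤ) * m i.succ := by
    rw [hN, Fin.sum_univ_succ]
    push_cast
    rfl
  rw [Fin.sum_univ_succ (fun i => (n i : ℤ) * (m i : ℤ) ^ 2)] at hsum
  zify at hrest hm1 hn1
  have hR : 0 ≤ ∑ i : Fin k, (n i.succ : ℤ) * m i.succ :=
    Finset.sum_nonneg fun i _ => by positivity
  have hNd := mul_le_mul_of_nonneg_left hd (Int.natCast_nonneg N)
  have hchoose := two_mul_choose_two_cast N
  generalize ∑ i : Fin k, (n i.succ : ℤ) * m i.succ = R at *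
  generalize (n 0 : ℤ) = a at *
  generalize (m 0 : ℤ) = b at *
  have hhead : 0 ≤ a * b * (a * b - b - 2 * a) :=
    mul_nonneg (by nlinarith) (by nlinarith)
  have hcross : 0 ≤ a * R * (b - 1) :=
    mul_nonneg (mul_nonneg (by linarith) hR) (by linarith)
  have hkey : a * b ^ 2 + R ^ 2 + 2 * (N * a) ≤ (N : ℤ) ^ 2 := by
    rw [hN']
    linarith
  linarith
end

section
/- Let N, n₁, m₁ be integers with m₁ ≥ 4, n₁ ≥ 2, and N ≥ n₁m₁. Then C(N,2) + n₁·C(m₁+1,2) + C(N − n₁m₁ + 1, 2) ≤ N·(N − n₁). -/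
/-- Let `N, n₁, m₁` be integers with `m₁ ≥ 4`, `n₁ ≥ 2` and
`N ≥ n₁m₁`.  Then `C(N,2) + n₁·C(m₁+1,2) + C(N − n₁m₁ + 1, 2) ≤ N·(N − n₁)`. -/
theorem choose_inequality_m1_ge_four
    (N n₁ m₁ : ℕ) (hm : 4 ≤ m₁) (hn : 2 ≤ n₁) (hN : n₁ * m₁ ≤ N) :
    N.choose 2 + n₁ * (m₁ + 1).choose 2 + (N - n₁ * m₁ + 1).choose 2
      ≤ N * (N - n₁) := by
  obtain ⟨k, rfl⟩ := Nat.exists_eq_add_of_le hN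
  obtain ⟨a, rfl⟩ := Nat.exists_eq_add_of_le hn
  obtain ⟨b, rfl⟩ := Nat.exists_eq_add_of_le hm
  have hle : 2 + a ≤ (2 + a) * (4 + b) + k := by nlinarith
  rw [Nat.add_sub_cancel_left, ← Nat.cast_le (α := ℚ)]
  push_cast [Nat.cast_choose_two, Nat.cast_sub hle]
  -- Twice the difference of the two sides is `n₁ (m₁ ((n₁ - 1) (m₁ - 2) - 2) + 2 k (m₁ - 1))`.
  have key : (0 : ℚ) ≤ (2 + a) * ((4 + b) * (2 * a + b + a * b) + 2 * k * (3 + b)) := by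
    positivity
  linarith
end
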